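/- Let H be a quasi-Hopf algebra over a field k with bijective antipode S (inverse S̄) and Drinfeld twist f with inverse f⁻¹ = f̄1⊗f̄2. Let f_op and f_cop denote the Drinfeld twists of the quasi-Hopf algebras H^op = (H^op, Δ, ε, φ⁻¹, S̄, S̄(β), S̄(α)) and H^cop = (H, Δ^cop, ε, φ̄3⊗φ̄2⊗φ̄1, S̄, S̄(α), S̄(β)) (computed by the same defining formula as f, using the structure data of H^op, respectively H^cop, in place of that of H). Then f_op = S̄(f̄2) ⊗ S̄(f̄1) and f_cop = S̄(f1) ⊗ S̄(f2). -/

import Mathlib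

open scoped TensorProduct

noncomputable section

/-- A quasi-Hopf algebra over a field `k`, presented together with explicit
(Sweedler-style) finite representations of the comultiplication and of the
associator `φ` and its inverse `φ⁻¹`.  The fields `n, d1, d2` give, for every
`h : H`, a finite family with `Δ h = ∑ i < n h, d1 h i ⊗ d2 h i`; similarly
`P1, P2, P3` (resp. `Q1, Q2, Q3`) are the components of `φ` (resp. `φ⁻¹`). -/
structure QuasiHopf (k H : Type) [Field k] [Ring H] [Algebra k H] where
  comul : H →ₐ[k] H ⊗[k] H
  counit : H →ₐ[k] k
  n : H → ℕ
  d1 : H → ℕ → H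
  d2 : H → ℕ → H
  comul_eq : ∀ h, comul h = ∑ i ∈ Finset.range (n h), d1 h i ⊗ₜ[k] d2 h i
  np : ℕ
  P1 : ℕ → H
  P2 : ℕ → H
  P3 : ℕ → H
  nq : ℕ
  Q1 : ℕ → H
  Q2 : ℕ → H
  Q3 : ℕ → H
  S : H →ₗ[k] H
  Sinv : H →ₗ[k] H
  alpha : H
  beta : H
  S_one : S 1 = 1
  S_mul : ∀ x y : H, S (x * y) = S y * S x
  Sinv_S : ∀ x : H, Sinv (S x) = x
  S_Sinv : ∀ x : H, S (Sinv x) = x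
  phi_phiInv :
    (∑ a ∈ Finset.range np, P1 a ⊗ₜ[k] (P2 a ⊗ₜ[k] P3 a)) *
      (∑ b ∈ Finset.range nq, Q1 b ⊗ₜ[k] (Q2 b ⊗ₜ[k] Q3 b)) = 1
  phiInv_phi :
    (∑ b ∈ Finset.range nq, Q1 b ⊗ₜ[k] (Q2 b ⊗ₜ[k] Q3 b)) *
      (∑ a ∈ Finset.range np, P1 a ⊗ₜ[k] (P2 a ⊗ₜ[k] P3 a)) = 1
  qcoassoc : ∀ h : H,
    ∑ i ∈ Finset.range (n h), d1 h i ⊗ₜ[k] comul (d2 h i) =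
      (∑ a ∈ Finset.range np, P1 a ⊗ₜ[k] (P2 a ⊗ₜ[k] P3 a)) *
        (∑ i ∈ Finset.range (n h), ∑ j ∈ Finset.range (n (d1 h i)),
          d1 (d1 h i) j ⊗ₜ[k] (d2 (d1 h i) j ⊗ₜ[k] d2 h i)) *
        (∑ b ∈ Finset.range nq, Q1 b ⊗ₜ[k] (Q2 b ⊗ₜ[k] Q3 b))
  counit_left : ∀ h : H, ∑ i ∈ Finset.range (n h), counit (d1 h i) • d2 h i = h
  counit_right : ∀ h : H, ∑ i ∈ Finset.range (n h), counit (d2 h i) • d1 h i = h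
  pentagon :
    (∑ a ∈ Finset.range np, P1 a ⊗ₜ[k] (P2 a ⊗ₜ[k] comul (P3 a))) *
      (∑ a ∈ Finset.range np, ∑ i ∈ Finset.range (n (P1 a)),
        d1 (P1 a) i ⊗ₜ[k] (d2 (P1 a) i ⊗ₜ[k] (P2 a ⊗ₜ[k] P3 a))) =
    ((1 : H) ⊗ₜ[k] (∑ a ∈ Finset.range np, P1 a ⊗ₜ[k] (P2 a ⊗ₜ[k] P3 a))) *
      (∑ a ∈ Finset.range np, ∑ i ∈ Finset.range (n (P2 a)),
        P1 a ⊗ₜ[k] (d1 (P2 a) i ⊗ₜ[k] (d2 (P2 a) i ⊗ₜ[k] P3 a))) *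
      (∑ a ∈ Finset.range np, P1 a ⊗ₜ[k] (P2 a ⊗ₜ[k] (P3 a ⊗ₜ[k] (1 : H))))
  counit_mid_phi :
    ∑ a ∈ Finset.range np, counit (P2 a) • (P1 a ⊗ₜ[k] P3 a) = (1 : H) ⊗ₜ[k] (1 : H)
  antipode_alpha : ∀ h : H,
    ∑ i ∈ Finset.range (n h), S (d1 h i) * alpha * d2 h i = counit h • alpha
  antipode_beta : ∀ h : H,
    ∑ i ∈ Finset.range (n h), d1 h i * beta * S (d2 h i) = counit h • beta
  nondeg_1 : ∑ a ∈ Finset.range np, P1 a * beta * S (P2 a) * alpha * P3 a = 1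
  nondeg_2 : ∑ b ∈ Finset.range nq, S (Q1 b) * alpha * Q2 b * beta * S (Q3 b) = 1
  counit_alpha : counit alpha = 1
  counit_beta : counit beta = 1

namespace QuasiHopf

variable {k H : Type} [Field k] [Ring H] [Algebra k H] (q : QuasiHopf k H)

/-- The associator `φ` as an element of `H ⊗ H ⊗ H`. -/
def Phi : H ⊗[k] (H ⊗[k] H) :=
  ∑ a ∈ Finset.range q.np, q.P1 a ⊗ₜ[k] (q.P2 a ⊗ₜ[k] q.P3 a)

/-- `φ⁻¹` as an element of `H ⊗ H ⊗ H`. -/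
def PhiInv : H ⊗[k] (H ⊗[k] H) :=
  ∑ b ∈ Finset.range q.nq, q.Q1 b ⊗ₜ[k] (q.Q2 b ⊗ₜ[k] q.Q3 b)

/-- first components of `p^R = φ̄1 ⊗ φ̄2 β S(φ̄3)` -/
def pR1 (b : ℕ) : H := q.Q1 b

def pR2 (b : ℕ) : H := q.Q2 b * q.beta * q.S (q.Q3 b)

def pRE : H ⊗[k] H := ∑ b ∈ Finset.range q.nq, q.pR1 b ⊗ₜ[k] q.pR2 b

/-- components of `q^R = φ1 ⊗ S̄(α φ3) φ2` -/
def qR1 (a : ℕ) : H := q.P1 a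

def qR2 (a : ℕ) : H := q.Sinv (q.alpha * q.P3 a) * q.P2 a

def qRE : H ⊗[k] H := ∑ a ∈ Finset.range q.np, q.qR1 a ⊗ₜ[k] q.qR2 a

/-- components of `p^L = φ2 S̄(φ1 β) ⊗ φ3` -/
def pL1 (a : ℕ) : H := q.P2 a * q.Sinv (q.P1 a * q.beta)

def pL2 (a : ℕ) : H := q.P3 a

def pLE : H ⊗[k] H := ∑ a ∈ Finset.range q.np, q.pL1 a ⊗ₜ[k] q.pL2 a

/-- components of `q^L = S(φ̄1) α φ̄2 ⊗ φ̄3` -/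
def qL1 (b : ℕ) : H := q.S (q.Q1 b) * q.alpha * q.Q2 b

def qL2 (b : ℕ) : H := q.Q3 b

def qLE : H ⊗[k] H := ∑ b ∈ Finset.range q.nq, q.qL1 b ⊗ₜ[k] q.qL2 b

/-- `𝕒 = S(φ̄1 φ2) α φ̄2 φ3₍₁₎ ⊗ S(φ1) α φ̄3 φ3₍₂₎` -/
def aEl : H ⊗[k] H :=
  ∑ a ∈ Finset.range q.np, ∑ b ∈ Finset.range q.nq, ∑ m ∈ Finset.range (q.n (q.P3 a)),
    (q.S (q.Q1 b * q.P2 a) * q.alpha * q.Q2 b * q.d1 (q.P3 a) m) ⊗ₜ[k]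
      (q.S (q.P1 a) * q.alpha * q.Q3 b * q.d2 (q.P3 a) m)

/-- `𝕓 = φ1₍₁₎ φ̄1 β S(φ3) ⊗ φ1₍₂₎ φ̄2 β S(φ2 φ̄3)` -/
def bEl : H ⊗[k] H :=
  ∑ a ∈ Finset.range q.np, ∑ b ∈ Finset.range q.nq, ∑ m ∈ Finset.range (q.n (q.P1 a)),
    (q.d1 (q.P1 a) m * q.Q1 b * q.beta * q.S (q.P3 a)) ⊗ₜ[k]
      (q.d2 (q.P1 a) m * q.Q2 b * q.beta * q.S (q.P2 a * q.Q3 b))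

/-- `(S ⊗ S)(Δ^cop x) = S(x₍₂₎) ⊗ S(x₍₁₎)` -/
def scop (x : H) : H ⊗[k] H :=
  ∑ m ∈ Finset.range (q.n x), q.S (q.d2 x m) ⊗ₜ[k] q.S (q.d1 x m)

/-- The Drinfeld twist `f = (S⊗S)(Δ^cop(p^R_1)) · 𝕒 · Δ(p^R_2)`. -/
def twist : H ⊗[k] H :=
  ∑ b ∈ Finset.range q.nq, q.scop (q.pR1 b) * q.aEl * q.comul (q.pR2 b)

/-- `f⁻¹ = Δ(q^L_1) · 𝕓 · (S⊗S)(Δ^cop(q^L_2))`. -/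
def twistInv : H ⊗[k] H :=
  ∑ b ∈ Finset.range q.nq, q.comul (q.qL1 b) * q.bEl * q.scop (q.qL2 b)

/-- `x ⊗ y ↦ S y ⊗ S x` -/
def sswap : H ⊗[k] H →ₗ[k] H ⊗[k] H :=
  (TensorProduct.map q.S q.S).comp (TensorProduct.comm k H H).toLinearMap

/-- `x ⊗ y ↦ S̄ y ⊗ S̄ x` -/
def sswapInv : H ⊗[k] H →ₗ[k] H ⊗[k] H :=
  (TensorProduct.map q.Sinv q.Sinv).comp (TensorProduct.comm k H H).toLinearMap

/-- `U^L = f̄1 S(q^R_2) ⊗ f̄2 S(q^R_1)` -/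
def UL : H ⊗[k] H := q.twistInv * q.sswap q.qRE

/-- `V^L = S̄(f2 p^R_2) ⊗ S̄(f1 p^R_1)` -/
def VL : H ⊗[k] H := q.sswapInv (q.twist * q.pRE)

/-- `U^R = S̄(q^L_2 f̄2) ⊗ S̄(q^L_1 f̄1)` -/
def UR : H ⊗[k] H := q.sswapInv (q.qLE * q.twistInv)

/-- `V^R = S(p^L_2) f1 ⊗ S(p^L_1) f2` -/
def VR : H ⊗[k] H := q.sswap q.pLE * q.twist

/-- `h ↦ h ↼ μ = μ(h₍₁₎) h₍₂₎` -/
def lhook (mu : H →ₐ[k] k) : H →ₗ[k] H :=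
  (TensorProduct.lid k H).toLinearMap.comp
    ((TensorProduct.map mu.toLinearMap LinearMap.id).comp q.comul.toLinearMap)

/-- `h ↦ μ ⇀ h = μ(h₍₂₎) h₍₁₎` -/
def rhook (mu : H →ₐ[k] k) : H →ₗ[k] H :=
  (TensorProduct.rid k H).toLinearMap.comp
    ((TensorProduct.map LinearMap.id mu.toLinearMap).comp q.comul.toLinearMap)

/-- `W^L = μ(φ̄1) f̄1 S(q^R_2 φ̄3) ⊗ f̄2 S((q^R_1 ↼ μ) φ̄2)` -/
def WL (mu : H →ₐ[k] k) : H ⊗[k] H :=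
  q.twistInv * q.sswap ((TensorProduct.map (q.lhook mu) LinearMap.id q.qRE) *
    (∑ b ∈ Finset.range q.nq, mu (q.Q1 b) • (q.Q2 b ⊗ₜ[k] q.Q3 b)))

/-- `W^R = μ(φ3) S̄((μ ⇀ q^L_2) φ2 f̄2) ⊗ S̄(q^L_1 φ1 f̄1)` -/
def WR (mu : H →ₐ[k] k) : H ⊗[k] H :=
  q.sswapInv ((TensorProduct.map LinearMap.id (q.rhook mu) q.qLE) *
    (∑ a ∈ Finset.range q.np, mu (q.P3 a) • (q.P1 a ⊗ₜ[k] q.P2 a)) * q.twistInv)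

section Modules

variable {V W X : Type} [AddCommGroup V] [Module k V] [AddCommGroup W] [Module k W]
  [AddCommGroup X] [Module k X]

/-- The tensor-product action `h · (v ⊗ w) = h₍₁₎ v ⊗ h₍₂₎ w`. -/
def tensAct (ρV : H → Module.End k V) (ρW : H → Module.End k W) (h : H) :
    Module.End k (V ⊗[k] W) :=
  ∑ i ∈ Finset.range (q.n h), TensorProduct.map (ρV (q.d1 h i)) (ρW (q.d2 h i))

/-- The action on the left dual: `(h · ξ)(x) = ξ(S(h) x)`. -/
def dualAct (ρX : H → Module.End k X) (h : H) : Module.End k (Module.Dual k X) :=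
  LinearMap.dualMap (ρX (q.S h))

end Modules

end QuasiHopf

/-- `f` intertwines the two given `H`-actions. -/
def IsHLin {k H V W : Type} [Field k] [Ring H] [Algebra k H]
    [AddCommGroup V] [Module k V] [AddCommGroup W] [Module k W]
    (ρV : H → Module.End k V) (ρW : H → Module.End k W) (f : V →ₗ[k] W) : Prop :=
  ∀ (h : H) (v : V), f (ρV h v) = ρW h (f v)

/-- `x ⊗ y ↦ λ(y) • x` -/
def hitR {k H : Type} [Field k] [Ring H] [Algebra k H] (lam : H →ₗ[k] k) :
    H ⊗[k] H →ₗ[k] H :=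
  (TensorProduct.rid k H).toLinearMap.comp (TensorProduct.map LinearMap.id lam)

/-- `x ⊗ y ↦ λ(x) • y` -/
def hitL {k H : Type} [Field k] [Ring H] [Algebra k H] (lam : H →ₗ[k] k) :
    H ⊗[k] H →ₗ[k] H :=
  (TensorProduct.lid k H).toLinearMap.comp (TensorProduct.map lam LinearMap.id)

namespace QuasiHopf

variable {k H : Type} [Field k] [Ring H] [Algebra k H] (q : QuasiHopf k H)

/-- `(S̄ ⊗ S̄)(Δ^cop x) = S̄(x₍₂₎) ⊗ S̄(x₍₁₎)`, the `scop` of `H^op`. -/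
def scopOp (x : H) : H ⊗[k] H :=
  ∑ m ∈ Finset.range (q.n x), q.Sinv (q.d2 x m) ⊗ₜ[k] q.Sinv (q.d1 x m)

/-- The element `𝕒` of the quasi-Hopf algebra
`H^op = (H^op, Δ, ε, φ⁻¹, S̄, S̄(β), S̄(α))`, computed by the defining formula of `𝕒`
from the structure data of `H^op` (all products written out in `H`;
recall that `(φ^op)⁻¹ = φ` and that products in `H^op` are reversed). -/
def aElOp : H ⊗[k] H :=
  ∑ b ∈ Finset.range q.nq, ∑ a ∈ Finset.range q.np, ∑ m ∈ Finset.range (q.n (q.Q3 b)),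
    (q.d1 (q.Q3 b) m * q.P2 a * q.Sinv q.beta * q.Sinv (q.Q2 b * q.P1 a)) ⊗ₜ[k]
      (q.d2 (q.Q3 b) m * q.P3 a * q.Sinv q.beta * q.Sinv (q.Q1 b))

/-- The Drinfeld twist of `H^op`, computed by the defining formula
`f_op = (S_op ⊗ S_op)(Δ_op^cop(p^R_op,1)) ·_op 𝕒_op ·_op Δ_op(p^R_op,2)` from the
structure data of `H^op`.  Here `p^R_op = φ1 ⊗ S̄(φ3) S̄(α) φ2` (a product in
`H^op ⊗ H^op` is the reversed product in `H ⊗ H`). -/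
def twistOp : H ⊗[k] H :=
  ∑ a ∈ Finset.range q.np,
    q.comul (q.Sinv (q.P3 a) * q.Sinv q.alpha * q.P2 a) * q.aElOp * q.scopOp (q.P1 a)

/-- `(S̄ ⊗ S̄)(Δ x) = S̄(x₍₁₎) ⊗ S̄(x₍₂₎)`, the `scop` of `H^cop`. -/
def scopCop (x : H) : H ⊗[k] H :=
  ∑ m ∈ Finset.range (q.n x), q.Sinv (q.d1 x m) ⊗ₜ[k] q.Sinv (q.d2 x m)

/-- `Δ^cop(x) = x₍₂₎ ⊗ x₍₁₎`. -/
def comulCop (x : H) : H ⊗[k] H :=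
  ∑ m ∈ Finset.range (q.n x), q.d2 x m ⊗ₜ[k] q.d1 x m

/-- The element `𝕒` of the quasi-Hopf algebra
`H^cop = (H, Δ^cop, ε, φ̄3 ⊗ φ̄2 ⊗ φ̄1, S̄, S̄(α), S̄(β))`, computed by the defining
formula of `𝕒` from the structure data of `H^cop`
(recall `(φ_cop)⁻¹ = φ3 ⊗ φ2 ⊗ φ1`). -/
def aElCop : H ⊗[k] H :=
  ∑ a ∈ Finset.range q.np, ∑ b ∈ Finset.range q.nq, ∑ m ∈ Finset.range (q.n (q.Q1 b)),
    (q.Sinv (q.P3 a * q.Q2 b) * q.Sinv q.alpha * q.P2 a * q.d2 (q.Q1 b) m) ⊗ₜ[k]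
      (q.Sinv (q.Q3 b) * q.Sinv q.alpha * q.P1 a * q.d1 (q.Q1 b) m)

/-- The Drinfeld twist of `H^cop`, computed by the defining formula
`f_cop = (S_cop ⊗ S_cop)(Δ_cop^cop(p^R_cop,1)) · 𝕒_cop · Δ_cop(p^R_cop,2)` from the
structure data of `H^cop`.  Here `p^R_cop = φ3 ⊗ φ2 S̄(β) S̄(φ1)`. -/
def twistCop : H ⊗[k] H :=
  ∑ a ∈ Finset.range q.np,
    q.scopCop (q.P3 a) * q.aElCop * q.comulCop (q.P2 a * q.Sinv q.beta * q.Sinv (q.P1 a))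

end QuasiHopf

/-- An additive property of elements of `A ⊗ B ⊗ C` holds once it holds on pure tensors. -/
theorem TensorProduct.induction_on_three {k A B C : Type} [Field k] [AddCommGroup A]
    [AddCommGroup B] [AddCommGroup C] [Module k A] [Module k B] [Module k C]
    {p : A ⊗[k] (B ⊗[k] C) → Prop} (z : A ⊗[k] (B ⊗[k] C)) (zero : p 0)
    (tmul : ∀ a b c, p (a ⊗ₜ (b ⊗ₜ c))) (add : ∀ x y, p x → p y → p (x + y)) : p z := by
  induction z using TensorProduct.induction_on with
  | zero => exact zero
  | add x y hx hy => exact add x y hx hy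
  | tmul a w =>
    induction w using TensorProduct.induction_on with
    | zero => simpa using zero
    | add x y hx hy => rw [TensorProduct.tmul_add]; exact add _ _ hx hy
    | tmul b c => exact tmul a b c

/-- An additive property of elements of `A ⊗ B ⊗ C ⊗ D` holds once it holds on pure tensors. -/
theorem TensorProduct.induction_on_four {k A B C D : Type} [Field k] [AddCommGroup A]
    [AddCommGroup B] [AddCommGroup C] [AddCommGroup D] [Module k A] [Module k B] [Module k C]
    [Module k D] {p : A ⊗[k] (B ⊗[k] (C ⊗[k] D)) → Prop} (z : A ⊗[k] (B ⊗[k] (C ⊗[k] D)))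
    (zero : p 0) (tmul : ∀ a b c d, p (a ⊗ₜ (b ⊗ₜ (c ⊗ₜ d))))
    (add : ∀ x y, p x → p y → p (x + y)) : p z := by
  induction z using TensorProduct.induction_on_three with
  | zero => exact zero
  | add x y hx hy => exact add x y hx hy
  | tmul a b w =>
    induction w using TensorProduct.induction_on with
    | zero => simpa using zero
    | add x y hx hy => rw [TensorProduct.tmul_add, TensorProduct.tmul_add]; exact add _ _ hx hy
    | tmul c d => exact tmul a b c d

/-- The linear map `x ⊗ y ↦ f x * g y`. -/
def mulMap {k A B K : Type} [Field k] [AddCommGroup A] [AddCommGroup B] [Module k A] [Module k B]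
    [Ring K] [Algebra k K] (f : A →ₗ[k] K) (g : B →ₗ[k] K) : A ⊗[k] B →ₗ[k] K :=
  (LinearMap.mul' k K).comp (TensorProduct.map f g)

@[simp]
theorem mulMap_tmul {k A B K : Type} [Field k] [AddCommGroup A] [AddCommGroup B] [Module k A]
    [Module k B] [Ring K] [Algebra k K] (f : A →ₗ[k] K) (g : B →ₗ[k] K) (x : A) (y : B) :
    mulMap f g (x ⊗ₜ y) = f x * g y := rfl

section TensorRing

/-! The ring axioms in `B ⊗ A`, stated for the syntactic form of the instances that also occurs in
iterated tensor products, where unification does not see through the instances of the factors. -/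

variable {k B A : Type} [Field k] [Ring B] [Algebra k B] [Ring A] [Algebra k A]

theorem tensor_mul_add (x y z : B ⊗[k] A) : x * (y + z) = x * y + x * z := mul_add x y z

theorem tensor_add_mul (x y z : B ⊗[k] A) : (x + y) * z = x * z + y * z := add_mul x y z

theorem tensor_mul_zero (x : B ⊗[k] A) : x * 0 = 0 := mul_zero x

theorem tensor_zero_mul (x : B ⊗[k] A) : 0 * x = 0 := zero_mul x

theorem tensor_mul_smul (c : k) (x y : B ⊗[k] A) : x * c • y = c • (x * y) := mul_smul_comm c x y

theorem tensor_smul_mul (c : k) (x y : B ⊗[k] A) : c • x * y = c • (x * y) := smul_mul_assoc c x y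

theorem tensor_mul_assoc (x y z : B ⊗[k] A) : x * y * z = x * (y * z) := mul_assoc x y z

theorem tensor_mul_one (x : B ⊗[k] A) : x * 1 = x := mul_one x

theorem tensor_one_mul (x : B ⊗[k] A) : 1 * x = x := one_mul x

theorem tensor_mul_sum {ι : Type} (s : Finset ι) (f : ι → B ⊗[k] A) (x : B ⊗[k] A) :
    x * ∑ i ∈ s, f i = ∑ i ∈ s, x * f i := Finset.mul_sum s f x

theorem tensor_sum_mul {ι : Type} (s : Finset ι) (f : ι → B ⊗[k] A) (x : B ⊗[k] A) :
    (∑ i ∈ s, f i) * x = ∑ i ∈ s, f i * x := Finset.sum_mul s f x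

end TensorRing

namespace QuasiHopf

variable {k H : Type} [Field k] [Ring H] [Algebra k H] (q : QuasiHopf k H)

/-- `Δ ⊗ id` -/
def comulFst : H ⊗[k] H →ₐ[k] H ⊗[k] (H ⊗[k] H) :=
  (Algebra.TensorProduct.assoc k k k H H H).toAlgHom.comp
    (Algebra.TensorProduct.map q.comul (AlgHom.id k H))

/-- `id ⊗ Δ` -/
def comulSnd : H ⊗[k] H →ₐ[k] H ⊗[k] (H ⊗[k] H) :=
  Algebra.TensorProduct.map (AlgHom.id k H) q.comul

/-- `Δ ⊗ id ⊗ id` -/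
def comulFst₃ : H ⊗[k] (H ⊗[k] H) →ₐ[k] H ⊗[k] (H ⊗[k] (H ⊗[k] H)) :=
  (Algebra.TensorProduct.assoc k k k H H (H ⊗[k] H)).toAlgHom.comp
    (Algebra.TensorProduct.map q.comul (AlgHom.id k (H ⊗[k] H)))

/-- `id ⊗ Δ ⊗ id` -/
def comulMid₃ : H ⊗[k] (H ⊗[k] H) →ₐ[k] H ⊗[k] (H ⊗[k] (H ⊗[k] H)) :=
  Algebra.TensorProduct.map (AlgHom.id k H) q.comulFst

/-- `id ⊗ id ⊗ Δ` -/
def comulLast₃ : H ⊗[k] (H ⊗[k] H) →ₐ[k] H ⊗[k] (H ⊗[k] (H ⊗[k] H)) :=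
  Algebra.TensorProduct.map (AlgHom.id k H) q.comulSnd

/-- `ε ⊗ id` -/
def counitFst {A : Type} [Ring A] [Algebra k A] : H ⊗[k] A →ₐ[k] A :=
  (Algebra.TensorProduct.lid k A).toAlgHom.comp
    (Algebra.TensorProduct.map q.counit (AlgHom.id k A))

/-- `id ⊗ ε` -/
def counitSnd : H ⊗[k] H →ₐ[k] H :=
  (Algebra.TensorProduct.rid k k H).toAlgHom.comp
    (Algebra.TensorProduct.map (AlgHom.id k H) q.counit)

/-- `id ⊗ ε ⊗ id` -/
def counitMid {A : Type} [Ring A] [Algebra k A] : H ⊗[k] (H ⊗[k] A) →ₐ[k] H ⊗[k] A :=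
  Algebra.TensorProduct.map (AlgHom.id k H) q.counitFst

/-- `id ⊗ id ⊗ ε` -/
def counitLast : H ⊗[k] (H ⊗[k] H) →ₐ[k] H ⊗[k] H :=
  Algebra.TensorProduct.map (AlgHom.id k H) q.counitSnd

variable (k H) in
/-- `x ↦ x ⊗ 1` -/
def tensOne : H ⊗[k] (H ⊗[k] H) →ₐ[k] H ⊗[k] (H ⊗[k] (H ⊗[k] H)) :=
  Algebra.TensorProduct.map (AlgHom.id k H)
    (Algebra.TensorProduct.map (AlgHom.id k H) Algebra.TensorProduct.includeLeft)

variable (k H) in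
/-- `x ↦ 1 ⊗ x` -/
def oneTens {A : Type} [Ring A] [Algebra k A] : A →ₐ[k] H ⊗[k] A :=
  Algebra.TensorProduct.includeRight

variable (k H) in
/-- `x ⊗ y ↦ x ⊗ 1 ⊗ 1 ⊗ y` -/
def outer : H ⊗[k] H →ₐ[k] H ⊗[k] (H ⊗[k] (H ⊗[k] H)) :=
  Algebra.TensorProduct.map (AlgHom.id k H) ((oneTens k H).comp (oneTens k H))

@[simp]
theorem comulFst_tmul (x y : H) : q.comulFst (x ⊗ₜ y) =
    ∑ i ∈ Finset.range (q.n x), q.d1 x i ⊗ₜ (q.d2 x i ⊗ₜ y) := by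
  simp [comulFst, q.comul_eq x, TensorProduct.sum_tmul]

@[simp]
theorem comulSnd_tmul (x y : H) : q.comulSnd (x ⊗ₜ y) = x ⊗ₜ q.comul y := rfl

@[simp]
theorem comulFst₃_tmul (x : H) (y : H ⊗[k] H) : q.comulFst₃ (x ⊗ₜ y) =
    ∑ i ∈ Finset.range (q.n x), q.d1 x i ⊗ₜ (q.d2 x i ⊗ₜ y) := by
  simp [comulFst₃, q.comul_eq x, TensorProduct.sum_tmul]

@[simp]
theorem comulMid₃_tmul (x : H) (y : H ⊗[k] H) : q.comulMid₃ (x ⊗ₜ y) = x ⊗ₜ q.comulFst y := rfl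

@[simp]
theorem comulLast₃_tmul (x : H) (y : H ⊗[k] H) : q.comulLast₃ (x ⊗ₜ y) = x ⊗ₜ q.comulSnd y := rfl

@[simp]
theorem counitFst_tmul {A : Type} [Ring A] [Algebra k A] (x : H) (y : A) :
    q.counitFst (x ⊗ₜ[k] y) = q.counit x • y := by
  simp [counitFst]

@[simp]
theorem counitSnd_tmul (x y : H) : q.counitSnd (x ⊗ₜ[k] y) = q.counit y • x := by
  simp [counitSnd]

@[simp]
theorem counitMid_tmul {A : Type} [Ring A] [Algebra k A] (x : H) (y : H ⊗[k] A) :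
    q.counitMid (x ⊗ₜ y) = x ⊗ₜ q.counitFst y := rfl

@[simp]
theorem counitLast_tmul (x : H) (y : H ⊗[k] H) :
    q.counitLast (x ⊗ₜ y) = x ⊗ₜ q.counitSnd y := rfl

@[simp]
theorem tensOne_tmul (x y z : H) :
    tensOne k H (x ⊗ₜ (y ⊗ₜ z)) = x ⊗ₜ (y ⊗ₜ (z ⊗ₜ 1)) := rfl

@[simp]
theorem oneTens_apply {A : Type} [Ring A] [Algebra k A] (x : A) : oneTens k H x = 1 ⊗ₜ x := rfl

@[simp]
theorem outer_tmul (x y : H) : outer k H (x ⊗ₜ y) = x ⊗ₜ (1 ⊗ₜ (1 ⊗ₜ y)) := rfl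

theorem tensOne_one : tensOne k H 1 = 1 := rfl

theorem oneTens_one {A : Type} [Ring A] [Algebra k A] : oneTens k H (1 : A) = 1 := rfl

theorem outer_one : outer k H 1 = 1 := rfl

theorem Phi_mul_PhiInv : q.Phi * q.PhiInv = 1 := q.phi_phiInv

theorem PhiInv_mul_Phi : q.PhiInv * q.Phi = 1 := q.phiInv_phi

/-- An algebra map sends `φ` and `φ⁻¹` to mutually inverse elements. -/
theorem map_Phi_mul_map_PhiInv {K : Type} [Ring K] [Algebra k K]
    (F : H ⊗[k] (H ⊗[k] H) →ₐ[k] K) : F q.Phi * F q.PhiInv = 1 := by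
  rw [← map_mul, Phi_mul_PhiInv, map_one]

theorem map_PhiInv_mul_map_Phi {K : Type} [Ring K] [Algebra k K]
    (F : H ⊗[k] (H ⊗[k] H) →ₐ[k] K) : F q.PhiInv * F q.Phi = 1 := by
  rw [← map_mul, PhiInv_mul_Phi, map_one]

theorem comulSnd_comul (h : H) :
    q.comulSnd (q.comul h) = q.Phi * q.comulFst (q.comul h) * q.PhiInv := by
  have := q.qcoassoc h
  simpa [q.comul_eq h, Phi, PhiInv] using this

theorem comulSnd_comul_mul_Phi (h : H) :
    q.comulSnd (q.comul h) * q.Phi = q.Phi * q.comulFst (q.comul h) := by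
  rw [comulSnd_comul, mul_assoc, PhiInv_mul_Phi, mul_one]

theorem PhiInv_mul_comulSnd_comul (h : H) :
    q.PhiInv * q.comulSnd (q.comul h) = q.comulFst (q.comul h) * q.PhiInv := by
  rw [comulSnd_comul, ← mul_assoc, ← mul_assoc, PhiInv_mul_Phi, one_mul]

theorem counitFst_comul (h : H) : q.counitFst (q.comul h) = h := by
  simpa [q.comul_eq h] using q.counit_left h

theorem counitSnd_comul (h : H) : q.counitSnd (q.comul h) = h := by
  simpa [q.comul_eq h] using q.counit_right h

theorem pentagon_Phi : q.comulLast₃ q.Phi * q.comulFst₃ q.Phi =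
    oneTens k H q.Phi * q.comulMid₃ q.Phi * tensOne k H q.Phi := by
  have := q.pentagon
  simpa [Phi, TensorProduct.tmul_sum] using this

theorem counitMid_Phi : q.counitMid q.Phi = 1 := by
  simpa [Phi, Algebra.TensorProduct.one_def] using q.counit_mid_phi

/-- `(id ⊗ ε)Δ = id` in the first tensor factor. -/
theorem counitMid_comulFst₃ (x : H ⊗[k] (H ⊗[k] H)) : q.counitMid (q.comulFst₃ x) = x := by
  induction x using TensorProduct.induction_on with
  | zero => simp
  | add x y hx hy => simp [hx, hy]
  | tmul a w =>
    conv_rhs => rw [← q.counit_right a]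
    simp [TensorProduct.sum_tmul, TensorProduct.smul_tmul]

theorem counitMid_comulFst (x : H ⊗[k] H) : q.counitMid (q.comulFst x) = x := by
  induction x using TensorProduct.induction_on with
  | zero => simp
  | add x y hx hy => simp [hx, hy]
  | tmul a w =>
    conv_rhs => rw [← q.counit_right a]
    simp [TensorProduct.sum_tmul, TensorProduct.smul_tmul]

theorem counitMid_comulSnd (x : H ⊗[k] H) : q.counitMid (q.comulSnd x) = x := by
  induction x using TensorProduct.induction_on with
  | zero => simp
  | add x y hx hy => simp [hx, hy]
  | tmul a w => simp [counitFst_comul]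

/-- `(ε ⊗ id ⊗ id)(φ) = 1` -/
theorem counitFst_Phi : q.counitFst q.Phi = 1 := by
  have h := congrArg q.counitMid q.pentagon_Phi
  have h₁ : q.counitMid (q.comulLast₃ q.Phi) = 1 := by
    have : ∀ x : H ⊗[k] (H ⊗[k] H),
        q.counitMid (q.comulLast₃ x) = q.comulSnd (q.counitMid x) := by
      intro x
      induction x using TensorProduct.induction_on_three with
      | zero => simp
      | add x y hx hy => simp [hx, hy]
      | tmul a b c => simp
    rw [this, counitMid_Phi, map_one]
  have h₂ : ∀ x : H ⊗[k] (H ⊗[k] H), q.counitMid (q.comulMid₃ x) = x := by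
    intro x
    induction x using TensorProduct.induction_on_three with
    | zero => simp
    | add x y hx hy => simp [hx, hy]
    | tmul a b c =>
      conv_rhs => rw [← q.counit_left b]
      simp [TensorProduct.sum_tmul, TensorProduct.tmul_sum, TensorProduct.smul_tmul]
  have h₃ : q.counitMid (tensOne k H q.Phi) = 1 := by
    have : ∀ x : H ⊗[k] (H ⊗[k] H), q.counitMid (tensOne k H x) =
        Algebra.TensorProduct.map (AlgHom.id k H) Algebra.TensorProduct.includeLeft
          (q.counitMid x) := by
      intro x
      induction x using TensorProduct.induction_on_three with
      | zero => simp
      | add x y hx hy => simp [hx, hy]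
      | tmul a b c => simp
    rw [this, counitMid_Phi, map_one]
  rw [map_mul, map_mul, map_mul, h₁, h₂, h₃, counitMid_comulFst₃, one_mul, mul_one] at h
  have h₄ := congrArg (fun t => q.counitFst (t * q.PhiInv)) h
  simpa [mul_assoc, Phi_mul_PhiInv] using h₄.symm

/-- `(id ⊗ id ⊗ ε)(φ) = 1` -/
theorem counitLast_Phi : q.counitLast q.Phi = 1 := by
  let E : H ⊗[k] (H ⊗[k] (H ⊗[k] H)) →ₐ[k] H ⊗[k] (H ⊗[k] H) :=
    Algebra.TensorProduct.map (AlgHom.id k H) q.counitMid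
  have hE : ∀ (a : H) (x : H ⊗[k] (H ⊗[k] H)), E (a ⊗ₜ x) = a ⊗ₜ q.counitMid x :=
    fun _ _ => rfl
  have h := congrArg E q.pentagon_Phi
  have h₁ : ∀ x : H ⊗[k] (H ⊗[k] H), E (q.comulLast₃ x) = x := by
    intro x
    induction x using TensorProduct.induction_on with
    | zero => simp
    | add x y hx hy => simp [hx, hy]
    | tmul a w => simp [hE, counitMid_comulSnd]
  have h₂ : E (q.comulFst₃ q.Phi) = 1 := by
    have : ∀ x : H ⊗[k] (H ⊗[k] H), E (q.comulFst₃ x) = q.comulFst (q.counitMid x) := by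
      intro x
      induction x using TensorProduct.induction_on_three with
      | zero => simp
      | add x y hx hy => simp [hx, hy]
      | tmul a b c => simp [hE, Finset.smul_sum]
    rw [this, counitMid_Phi, map_one]
  have h₃ : ∀ x : H ⊗[k] (H ⊗[k] H), E (q.comulMid₃ x) = x := by
    intro x
    induction x using TensorProduct.induction_on with
    | zero => simp
    | add x y hx hy => simp [hx, hy]
    | tmul a w => simp [hE, counitMid_comulFst]
  have h₄ : E (oneTens k H q.Phi) = 1 := by
    simp [hE, counitMid_Phi, Algebra.TensorProduct.one_def]
  have h₅ : ∀ x : H ⊗[k] (H ⊗[k] H), E (tensOne k H x) =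
      Algebra.TensorProduct.map (AlgHom.id k H) Algebra.TensorProduct.includeLeft
        (q.counitLast x) := by
    intro x
    induction x using TensorProduct.induction_on_three with
    | zero => simp
    | add x y hx hy => simp [hx, hy]
    | tmul a b c => simp [hE]
  rw [map_mul, map_mul, map_mul, h₁, h₂, h₃, h₄, h₅, one_mul, mul_one] at h
  have h₆ := congrArg (fun t => q.counitLast (q.PhiInv * t)) h
  have h₇ : ∀ x : H ⊗[k] H, q.counitLast (Algebra.TensorProduct.map (AlgHom.id k H)
      Algebra.TensorProduct.includeLeft x) = x := by
    intro x
    induction x using TensorProduct.induction_on with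
    | zero => simp
    | add x y hx hy => simp only [map_add, hx, hy]
    | tmul a w => simp
  simp only [← mul_assoc, PhiInv_mul_Phi, one_mul, map_one, h₇] at h₆
  exact h₆.symm

section Sandwich

variable {K : Type} [Ring K] [Algebra k K]

/-- The linear map `x ⊗ y ⊗ z ↦ D(S(x) α y) b G(z)`. -/
def evalAlpha (D : H →ₐ[k] K) (G : H →ₗ[k] K) (b : K) : H ⊗[k] (H ⊗[k] H) →ₗ[k] K :=
  mulMap (D.toLinearMap.comp q.S) (mulMap (D.toLinearMap.comp (LinearMap.mulLeft k q.alpha))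
    ((LinearMap.mulLeft k b).comp G))

/-- The linear map `x ⊗ y ⊗ z ↦ G(x) a D(y β S(z))`. -/
def evalBeta (D : H →ₐ[k] K) (G : H →ₗ[k] K) (a : K) : H ⊗[k] (H ⊗[k] H) →ₗ[k] K :=
  mulMap ((LinearMap.mulRight k a).comp G)
    (mulMap (D.toLinearMap.comp (LinearMap.mulRight k q.beta)) (D.toLinearMap.comp q.S))

/-- The linear map `w ⊗ x ⊗ y ⊗ z ↦ D(w β S(x) α y) b G(z)`. -/
def evalBetaAlpha (D : H →ₐ[k] K) (G : H →ₗ[k] K) (b : K) :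
    H ⊗[k] (H ⊗[k] (H ⊗[k] H)) →ₗ[k] K :=
  mulMap (D.toLinearMap.comp (LinearMap.mulRight k q.beta)) (q.evalAlpha D G b)

/-- The linear map `w ⊗ x ⊗ y ⊗ z ↦ G(w) a D(x β S(y) α z)`. -/
def evalAlphaBeta (D : H →ₐ[k] K) (G : H →ₗ[k] K) (a : K) :
    H ⊗[k] (H ⊗[k] (H ⊗[k] H)) →ₗ[k] K :=
  mulMap ((LinearMap.mulRight k a).comp G)
    (mulMap (D.toLinearMap.comp (LinearMap.mulRight k q.beta))
      (mulMap (D.toLinearMap.comp q.S) (D.toLinearMap.comp (LinearMap.mulLeft k q.alpha))))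

@[simp]
theorem evalAlpha_tmul (D : H →ₐ[k] K) (G : H →ₗ[k] K) (b : K) (x y z : H) :
    q.evalAlpha D G b (x ⊗ₜ (y ⊗ₜ z)) = D (q.S x) * (D q.alpha * D y * (b * G z)) := by
  simp [evalAlpha]

@[simp]
theorem evalBeta_tmul (D : H →ₐ[k] K) (G : H →ₗ[k] K) (a : K) (x y z : H) :
    q.evalBeta D G a (x ⊗ₜ (y ⊗ₜ z)) = G x * a * (D y * D q.beta * D (q.S z)) := by
  simp [evalBeta]

@[simp]
theorem evalBetaAlpha_tmul (D : H →ₐ[k] K) (G : H →ₗ[k] K) (b : K) (w : H)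
    (x : H ⊗[k] (H ⊗[k] H)) :
    q.evalBetaAlpha D G b (w ⊗ₜ x) = D w * D q.beta * q.evalAlpha D G b x := by
  simp [evalBetaAlpha]

@[simp]
theorem evalAlphaBeta_tmul (D : H →ₐ[k] K) (G : H →ₗ[k] K) (a : K) (w x y z : H) :
    q.evalAlphaBeta D G a (w ⊗ₜ (x ⊗ₜ (y ⊗ₜ z))) =
      G w * a * (D x * D q.beta * (D (q.S y) * (D q.alpha * D z))) := by
  simp [evalAlphaBeta]

/-- `D(S(h₍₁₎)) D(α) D(h₍₂₎) = ε(h) D(α)` -/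
theorem sum_map_antipode_alpha (D : H →ₐ[k] K) (h : H) :
    ∑ i ∈ Finset.range (q.n h), D (q.S (q.d1 h i)) * D q.alpha * D (q.d2 h i) =
      q.counit h • D q.alpha := by
  simp_rw [← map_mul, ← map_sum, antipode_alpha, map_smul]

theorem sum_map_antipode_beta (D : H →ₐ[k] K) (h : H) :
    ∑ i ∈ Finset.range (q.n h), D (q.d1 h i) * D q.beta * D (q.S (q.d2 h i)) =
      q.counit h • D q.beta := by
  simp_rw [← map_mul, ← map_sum, antipode_beta, map_smul]

section Left

variable {D : H →ₐ[k] K} {G : H →ₗ[k] K} {b : K}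

theorem evalAlpha_mul_comulSnd (hG : ∀ x y, G (x * y) = G y * G x)
    (hb : ∀ h, ∑ i ∈ Finset.range (q.n h), D (q.d1 h i) * b * G (q.d2 h i) = q.counit h • b)
    (x : H ⊗[k] (H ⊗[k] H)) (w : H ⊗[k] H) :
    q.evalAlpha D G b (x * q.comulSnd w) = D (q.S (q.counitSnd w)) * q.evalAlpha D G b x := by
  induction w using TensorProduct.induction_on with
  | zero => simp
  | add w w' hw hw' => simp [mul_add, add_mul, hw, hw']
  | tmul u v =>
    induction x using TensorProduct.induction_on_three with
    | zero => simp
    | add x y hx hy => simp only [add_mul, mul_add, map_add, hx, hy]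
    | tmul x y z =>
      have := congrArg (fun t => D (q.S u) * (D (q.S x) * (D q.alpha * D y * (t * G z)))) (hb v)
      simpa [q.comul_eq v, Finset.mul_sum, Finset.sum_mul, TensorProduct.tmul_sum, q.S_mul, hG,
        mul_assoc] using this

theorem evalAlpha_comulFst_mul (hG : ∀ x y, G (x * y) = G y * G x)
    (x : H ⊗[k] (H ⊗[k] H)) (w : H ⊗[k] H) :
    q.evalAlpha D G b (q.comulFst w * x) = q.evalAlpha D G b x * G (q.counitFst w) := by
  induction w using TensorProduct.induction_on with
  | zero => simp
  | add w w' hw hw' => simp [mul_add, add_mul, hw, hw']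
  | tmul u v =>
    induction x using TensorProduct.induction_on_three with
    | zero => simp
    | add x y hx hy => simp only [add_mul, mul_add, map_add, hx, hy]
    | tmul x y z =>
      have := congrArg (fun t => D (q.S x) * (t * D y * (b * (G z * G v))))
        (q.sum_map_antipode_alpha D u)
      simpa [Finset.mul_sum, Finset.sum_mul, q.S_mul, hG, mul_assoc] using this

/-- `D(S(h)) y = y G(h)` for `y = D(q^L_1) b G(q^L_2)`. -/
theorem map_antipode_mul_evalAlpha_PhiInv (hG : ∀ x y, G (x * y) = G y * G x)
    (hb : ∀ h, ∑ i ∈ Finset.range (q.n h), D (q.d1 h i) * b * G (q.d2 h i) = q.counit h • b)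
    (h : H) :
    D (q.S h) * q.evalAlpha D G b q.PhiInv = q.evalAlpha D G b q.PhiInv * G h := by
  have := congrArg (q.evalAlpha D G b) (q.PhiInv_mul_comulSnd_comul h)
  rwa [q.evalAlpha_mul_comulSnd hG hb, q.evalAlpha_comulFst_mul hG, counitSnd_comul,
    counitFst_comul] at this

theorem evalBetaAlpha_mul_comulFst₃ (hG : ∀ x y, G (x * y) = G y * G x)
    (z : H ⊗[k] (H ⊗[k] (H ⊗[k] H))) (w : H ⊗[k] (H ⊗[k] H)) :
    q.evalBetaAlpha D G b (z * q.comulFst₃ w) =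
      q.evalBetaAlpha D G b (z * oneTens k H (oneTens k H (q.counitFst w))) := by
  induction w using TensorProduct.induction_on_three with
  | zero => simp [tensor_mul_zero]
  | add w w' hw hw' => simp only [map_add, tensor_mul_add, hw, hw']
  | tmul h c d =>
    induction z using TensorProduct.induction_on_four with
    | zero => simp [tensor_zero_mul]
    | add x y hx hy => simp only [tensor_add_mul, map_add, hx, hy]
    | tmul x y z v =>
      have := congrArg (fun t => D x * (t * (D (q.S y) * (D q.alpha * (D z * (D c *
        (b * (G d * G v)))))))) (q.sum_map_antipode_beta D h)
      simpa [tensor_mul_sum, tensor_sum_mul, tensor_mul_smul, tensor_smul_mul, Finset.mul_sum,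
        Finset.sum_mul, q.S_mul, hG, mul_assoc] using this

theorem evalBetaAlpha_mul_comulLast₃ (hG : ∀ x y, G (x * y) = G y * G x)
    (hb : ∀ h, ∑ i ∈ Finset.range (q.n h), D (q.d1 h i) * b * G (q.d2 h i) = q.counit h • b)
    (z : H ⊗[k] (H ⊗[k] (H ⊗[k] H))) (w : H ⊗[k] (H ⊗[k] H)) :
    q.evalBetaAlpha D G b (z * q.comulLast₃ w) = q.evalBetaAlpha D G b
      (z * tensOne k H (Algebra.TensorProduct.map (AlgHom.id k H)
        Algebra.TensorProduct.includeLeft (q.counitLast w))) := by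
  induction w using TensorProduct.induction_on_three with
  | zero => simp [tensor_mul_zero]
  | add w w' hw hw' => simp only [map_add, tensor_mul_add, hw, hw']
  | tmul c d h =>
    induction z using TensorProduct.induction_on_four with
    | zero => simp [tensor_zero_mul]
    | add x y hx hy => simp only [tensor_add_mul, map_add, hx, hy]
    | tmul x y z v =>
      have := congrArg (fun t => D x * (D c * (D q.beta * (D (q.S d) * (D (q.S y) *
        (D q.alpha * (D z * (t * G v)))))))) (hb h)
      simpa [q.comul_eq h, tensor_mul_sum, tensor_sum_mul, tensor_mul_smul, tensor_smul_mul,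
        Finset.mul_sum, Finset.sum_mul, TensorProduct.tmul_sum, q.S_mul, hG, mul_assoc] using this

theorem evalBetaAlpha_comulMid₃_mul_tensOne (w x : H ⊗[k] (H ⊗[k] H)) :
    q.evalBetaAlpha D G b (q.comulMid₃ w * tensOne k H x) =
      mulMap D.toLinearMap ((LinearMap.mulLeft k (mulMap
        (D.toLinearMap.comp (LinearMap.mulRight k q.beta)) (mulMap (D.toLinearMap.comp q.S)
          (D.toLinearMap.comp (LinearMap.mulLeft k q.alpha))) x * b)).comp G)
        (q.counitMid w) := by
  induction w using TensorProduct.induction_on_three with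
  | zero => simp [tensor_zero_mul]
  | add w w' hw hw' => simp only [map_add, tensor_add_mul, hw, hw']
  | tmul c h d =>
    induction x using TensorProduct.induction_on_three with
    | zero => simp [tensor_mul_zero]
    | add x y hx hy =>
      simp only [counitMid_tmul, counitFst_tmul, mulMap_tmul, LinearMap.comp_apply,
        LinearMap.mulLeft_apply] at hx hy ⊢
      simp only [map_add, tensor_mul_add, mul_add, add_mul, hx, hy]
    | tmul x y z =>
      have := congrArg (fun t => D c * (D x * (D q.beta * (D (q.S y) *
        (t * (D z * (b * G d))))))) (q.sum_map_antipode_alpha D h)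
      simpa [tensor_mul_sum, tensor_sum_mul, Finset.mul_sum, Finset.sum_mul, TensorProduct.tmul_sum,
        q.S_mul, mul_assoc] using this

/-- `D(β) y = b` for `y = D(q^L_1) b G(q^L_2)`. -/
theorem map_beta_mul_evalAlpha_PhiInv (hG : ∀ x y, G (x * y) = G y * G x) (hG₁ : G 1 = 1)
    (hb : ∀ h, ∑ i ∈ Finset.range (q.n h), D (q.d1 h i) * b * G (q.d2 h i) = q.counit h • b) :
    D q.beta * q.evalAlpha D G b q.PhiInv = b := by
  have hn : mulMap (D.toLinearMap.comp (LinearMap.mulRight k q.beta))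
      (mulMap (D.toLinearMap.comp q.S) (D.toLinearMap.comp (LinearMap.mulLeft k q.alpha)))
      q.Phi = 1 := by
    simpa [Phi, mul_assoc] using congrArg D q.nondeg_1
  have h₁ := q.evalBetaAlpha_comulMid₃_mul_tensOne (b := b) (D := D) (G := G) q.Phi q.Phi
  have h₂ : q.comulMid₃ q.Phi * tensOne k H q.Phi =
      oneTens k H q.PhiInv * q.comulLast₃ q.Phi * q.comulFst₃ q.Phi := by
    rw [tensor_mul_assoc, pentagon_Phi, tensor_mul_assoc,
      ← tensor_mul_assoc (oneTens k H q.PhiInv), map_PhiInv_mul_map_Phi, tensor_one_mul]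
  rw [h₂, q.evalBetaAlpha_mul_comulFst₃ hG, counitFst_Phi, oneTens_one, oneTens_one, tensor_mul_one,
    q.evalBetaAlpha_mul_comulLast₃ hG hb, counitLast_Phi, map_one, tensOne_one, tensor_mul_one, hn,
    counitMid_Phi] at h₁
  simpa [Algebra.TensorProduct.one_def, hG₁] using h₁

/-- `D(q^R_1) b G(q^R_2) = D(q^L_1) b G(q^L_2)` for an invariant element `b`. -/
theorem sum_qR_eq_sum_qL (hG : ∀ x y, G (x * y) = G y * G x) (hG₁ : G 1 = 1)
    (hb : ∀ h, ∑ i ∈ Finset.range (q.n h), D (q.d1 h i) * b * G (q.d2 h i) = q.counit h • b) :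
    ∑ i ∈ Finset.range q.np, D (q.qR1 i) * b * G (q.qR2 i) =
      ∑ j ∈ Finset.range q.nq, D (q.qL1 j) * b * G (q.qL2 j) := by
  have hy : ∑ j ∈ Finset.range q.nq, D (q.qL1 j) * b * G (q.qL2 j) =
      q.evalAlpha D G b q.PhiInv := by
    simp [qL1, qL2, PhiInv, mul_assoc]
  rw [hy]
  have hn := congrArg (fun t => D t * q.evalAlpha D G b q.PhiInv) q.nondeg_1
  simp only [map_sum, map_one, one_mul, Finset.sum_mul] at hn
  refine Eq.trans (Finset.sum_congr rfl fun i _ => ?_) hn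
  conv_lhs => rw [← q.map_beta_mul_evalAlpha_PhiInv hG hG₁ hb]
  rw [qR1, qR2, hG, mul_assoc, mul_assoc, ← mul_assoc _ (G (q.P2 i)),
    ← q.map_antipode_mul_evalAlpha_PhiInv hG hb, mul_assoc (D (q.S (q.P2 i))),
    ← q.map_antipode_mul_evalAlpha_PhiInv hG hb, q.S_Sinv]
  simp [mul_assoc]

end Left

section Right

variable {D : H →ₐ[k] K} {G : H →ₗ[k] K} {a : K}

theorem evalBeta_mul_comulSnd (hG : ∀ x y, G (x * y) = G y * G x)
    (x : H ⊗[k] (H ⊗[k] H)) (w : H ⊗[k] H) :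
    q.evalBeta D G a (x * q.comulSnd w) = G (q.counitSnd w) * q.evalBeta D G a x := by
  induction w using TensorProduct.induction_on with
  | zero => simp
  | add w w' hw hw' => simp [mul_add, add_mul, hw, hw']
  | tmul u v =>
    induction x using TensorProduct.induction_on_three with
    | zero => simp
    | add x y hx hy => simp only [add_mul, mul_add, map_add, hx, hy]
    | tmul x y z =>
      have := congrArg (fun t => G u * (G x * (a * (D y * (t * D (q.S z))))))
        (q.sum_map_antipode_beta D v)
      simpa [q.comul_eq v, Finset.mul_sum, Finset.sum_mul, TensorProduct.tmul_sum, q.S_mul, hG,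
        mul_assoc] using this

theorem evalBeta_comulFst_mul (hG : ∀ x y, G (x * y) = G y * G x)
    (ha : ∀ h, ∑ i ∈ Finset.range (q.n h), G (q.d1 h i) * a * D (q.d2 h i) = q.counit h • a)
    (x : H ⊗[k] (H ⊗[k] H)) (w : H ⊗[k] H) :
    q.evalBeta D G a (q.comulFst w * x) = q.evalBeta D G a x * D (q.S (q.counitFst w)) := by
  induction w using TensorProduct.induction_on with
  | zero => simp
  | add w w' hw hw' => simp [mul_add, add_mul, hw, hw']
  | tmul u v =>
    induction x using TensorProduct.induction_on_three with
    | zero => simp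
    | add x y hx hy => simp only [add_mul, mul_add, map_add, hx, hy]
    | tmul x y z =>
      have := congrArg (fun t => G x * (t * (D y * (D q.beta * (D (q.S z) * D (q.S v))))))
        (ha u)
      simpa [Finset.mul_sum, Finset.sum_mul, q.S_mul, hG, mul_assoc] using this

/-- `x D(S(h)) = G(h) x` for `x = G(p^R_1) a D(p^R_2)`. -/
theorem evalBeta_PhiInv_mul_map_antipode (hG : ∀ x y, G (x * y) = G y * G x)
    (ha : ∀ h, ∑ i ∈ Finset.range (q.n h), G (q.d1 h i) * a * D (q.d2 h i) = q.counit h • a)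
    (h : H) :
    q.evalBeta D G a q.PhiInv * D (q.S h) = G h * q.evalBeta D G a q.PhiInv := by
  have := congrArg (q.evalBeta D G a) (q.PhiInv_mul_comulSnd_comul h)
  rw [q.evalBeta_mul_comulSnd hG, q.evalBeta_comulFst_mul hG ha, counitSnd_comul,
    counitFst_comul] at this
  exact this.symm

theorem evalAlphaBeta_comulLast₃_mul (hG : ∀ x y, G (x * y) = G y * G x)
    (z : H ⊗[k] (H ⊗[k] (H ⊗[k] H))) (w : H ⊗[k] (H ⊗[k] H)) :
    q.evalAlphaBeta D G a (q.comulLast₃ w * z) = q.evalAlphaBeta D G a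
      (tensOne k H (Algebra.TensorProduct.map (AlgHom.id k H)
        Algebra.TensorProduct.includeLeft (q.counitLast w)) * z) := by
  induction w using TensorProduct.induction_on_three with
  | zero => simp [tensor_zero_mul]
  | add w w' hw hw' => simp only [map_add, tensor_add_mul, hw, hw']
  | tmul c d h =>
    induction z using TensorProduct.induction_on_four with
    | zero => simp [tensor_mul_zero]
    | add x y hx hy => simp only [tensor_mul_add, map_add, hx, hy]
    | tmul x y z v =>
      have := congrArg (fun t => G x * (G c * (a * (D d * (D y * (D q.beta * (D (q.S z) *
        (t * D v)))))))) (q.sum_map_antipode_alpha D h)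
      simpa [q.comul_eq h, tensor_mul_sum, tensor_sum_mul, tensor_mul_smul, tensor_smul_mul,
        Finset.mul_sum, Finset.sum_mul, TensorProduct.tmul_sum, q.S_mul, hG, mul_assoc] using this

theorem evalAlphaBeta_comulFst₃_mul (hG : ∀ x y, G (x * y) = G y * G x)
    (ha : ∀ h, ∑ i ∈ Finset.range (q.n h), G (q.d1 h i) * a * D (q.d2 h i) = q.counit h • a)
    (z : H ⊗[k] (H ⊗[k] (H ⊗[k] H))) (w : H ⊗[k] (H ⊗[k] H)) :
    q.evalAlphaBeta D G a (q.comulFst₃ w * z) =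
      q.evalAlphaBeta D G a (oneTens k H (oneTens k H (q.counitFst w)) * z) := by
  induction w using TensorProduct.induction_on_three with
  | zero => simp [tensor_zero_mul]
  | add w w' hw hw' => simp only [map_add, tensor_add_mul, hw, hw']
  | tmul h c d =>
    induction z using TensorProduct.induction_on_four with
    | zero => simp [tensor_mul_zero]
    | add x y hx hy => simp only [tensor_mul_add, map_add, hx, hy]
    | tmul x y z v =>
      have := congrArg (fun t => G x * (t * (D y * (D q.beta * (D (q.S z) * (D (q.S c) *
        (D q.alpha * (D d * D v)))))))) (ha h)
      simpa [tensor_mul_sum, tensor_sum_mul, tensor_mul_smul, tensor_smul_mul, Finset.mul_sum,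
        Finset.sum_mul, q.S_mul, hG, mul_assoc] using this

theorem evalAlphaBeta_oneTens_mul_comulMid₃ (w x : H ⊗[k] (H ⊗[k] H)) :
    q.evalAlphaBeta D G a (oneTens k H x * q.comulMid₃ w) =
      mulMap ((LinearMap.mulRight k (a * mulMap
        (D.toLinearMap.comp (LinearMap.mulRight k q.beta)) (mulMap (D.toLinearMap.comp q.S)
          (D.toLinearMap.comp (LinearMap.mulLeft k q.alpha))) x)).comp G) D.toLinearMap
        (q.counitMid w) := by
  induction w using TensorProduct.induction_on_three with
  | zero => simp
  | add w w' hw hw' => simp only [map_add, tensor_mul_add, hw, hw']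
  | tmul c h d =>
    induction x using TensorProduct.induction_on_three with
    | zero => simp
    | add x y hx hy =>
      simp only [counitMid_tmul, counitFst_tmul, mulMap_tmul, LinearMap.comp_apply,
        LinearMap.mulRight_apply] at hx hy ⊢
      simp only [map_add, mul_add, add_mul, hx, hy]
    | tmul x y z =>
      have := congrArg (fun t => G c * (a * (D x * (t * (D (q.S y) *
        (D q.alpha * (D z * D d))))))) (q.sum_map_antipode_beta D h)
      simpa [tensor_mul_sum, tensor_sum_mul, Finset.mul_sum, Finset.sum_mul, TensorProduct.tmul_sum,
        q.S_mul, mul_assoc] using this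

/-- `x D(α) = a` for `x = G(p^R_1) a D(p^R_2)`. -/
theorem evalBeta_PhiInv_mul_map_alpha (hG : ∀ x y, G (x * y) = G y * G x) (hG₁ : G 1 = 1)
    (ha : ∀ h, ∑ i ∈ Finset.range (q.n h), G (q.d1 h i) * a * D (q.d2 h i) = q.counit h • a) :
    q.evalBeta D G a q.PhiInv * D q.alpha = a := by
  have hn : mulMap (D.toLinearMap.comp (LinearMap.mulRight k q.beta))
      (mulMap (D.toLinearMap.comp q.S) (D.toLinearMap.comp (LinearMap.mulLeft k q.alpha)))
      q.Phi = 1 := by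
    simpa [Phi, mul_assoc] using congrArg D q.nondeg_1
  have h₁ := q.evalAlphaBeta_oneTens_mul_comulMid₃ (a := a) (D := D) (G := G) q.Phi q.Phi
  have h₂ : oneTens k H q.Phi * q.comulMid₃ q.Phi =
      q.comulLast₃ q.Phi * (q.comulFst₃ q.Phi * tensOne k H q.PhiInv) := by
    rw [← tensor_mul_assoc, pentagon_Phi, tensor_mul_assoc, map_Phi_mul_map_PhiInv,
      tensor_mul_one]
  rw [h₂, q.evalAlphaBeta_comulLast₃_mul hG, counitLast_Phi, map_one, tensOne_one, tensor_one_mul,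
    q.evalAlphaBeta_comulFst₃_mul hG ha, counitFst_Phi, oneTens_one, oneTens_one, tensor_one_mul,
    hn, counitMid_Phi] at h₁
  simpa [Algebra.TensorProduct.one_def, hG₁, PhiInv, Finset.sum_mul, mul_assoc] using h₁

/-- `G(p^L_1) a D(p^L_2) = G(p^R_1) a D(p^R_2)` for an invariant element `a`. -/
theorem sum_pL_eq_sum_pR (hG : ∀ x y, G (x * y) = G y * G x) (hG₁ : G 1 = 1)
    (ha : ∀ h, ∑ i ∈ Finset.range (q.n h), G (q.d1 h i) * a * D (q.d2 h i) = q.counit h • a) :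
    ∑ i ∈ Finset.range q.np, G (q.pL1 i) * a * D (q.pL2 i) =
      ∑ j ∈ Finset.range q.nq, G (q.pR1 j) * a * D (q.pR2 j) := by
  have hx : ∑ j ∈ Finset.range q.nq, G (q.pR1 j) * a * D (q.pR2 j) =
      q.evalBeta D G a q.PhiInv := by
    simp [pR1, pR2, PhiInv, mul_assoc]
  rw [hx]
  have hn := congrArg (fun t => q.evalBeta D G a q.PhiInv * D t) q.nondeg_1
  simp only [map_sum, map_one, mul_one, Finset.mul_sum] at hn
  refine Eq.trans (Finset.sum_congr rfl fun i _ => ?_) hn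
  conv_lhs => rw [← q.evalBeta_PhiInv_mul_map_alpha hG hG₁ ha]
  rw [pL1, pL2, hG, ← mul_assoc, mul_assoc _ (G (q.P2 i)),
    ← q.evalBeta_PhiInv_mul_map_antipode hG ha, ← mul_assoc,
    ← q.evalBeta_PhiInv_mul_map_antipode hG ha, q.S_Sinv]
  simp [mul_assoc]

end Right

end Sandwich

theorem Sinv_mul (x y : H) : q.Sinv (x * y) = q.Sinv y * q.Sinv x := by
  rw [← q.Sinv_S (q.Sinv y * q.Sinv x), q.S_mul, q.S_Sinv, q.S_Sinv]

@[simp]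
theorem sswap_tmul (x y : H) : q.sswap (x ⊗ₜ y) = q.S y ⊗ₜ q.S x := rfl

@[simp]
theorem sswapInv_tmul (x y : H) : q.sswapInv (x ⊗ₜ y) = q.Sinv y ⊗ₜ q.Sinv x := rfl

theorem sswap_mul (x y : H ⊗[k] H) : q.sswap (x * y) = q.sswap y * q.sswap x := by
  induction x using TensorProduct.induction_on with
  | zero => simp
  | add x x' hx hx' => simp only [add_mul, mul_add, map_add, hx, hx']
  | tmul a b =>
    induction y using TensorProduct.induction_on with
    | zero => simp
    | add y y' hy hy' => simp only [add_mul, mul_add, map_add, hy, hy']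
    | tmul c d => simp [q.S_mul]

theorem sswapInv_mul (x y : H ⊗[k] H) : q.sswapInv (x * y) = q.sswapInv y * q.sswapInv x := by
  induction x using TensorProduct.induction_on with
  | zero => simp
  | add x x' hx hx' => simp only [add_mul, mul_add, map_add, hx, hx']
  | tmul a b =>
    induction y using TensorProduct.induction_on with
    | zero => simp
    | add y y' hy hy' => simp only [add_mul, mul_add, map_add, hy, hy']
    | tmul c d => simp [q.Sinv_mul]

theorem map_Sinv_mul (x y : H ⊗[k] H) : TensorProduct.map q.Sinv q.Sinv (x * y) =
    TensorProduct.map q.Sinv q.Sinv y * TensorProduct.map q.Sinv q.Sinv x := by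
  induction x using TensorProduct.induction_on with
  | zero => simp
  | add x x' hx hx' => simp only [add_mul, mul_add, map_add, hx, hx']
  | tmul a b =>
    induction y using TensorProduct.induction_on with
    | zero => simp
    | add y y' hy hy' => simp only [add_mul, mul_add, map_add, hy, hy']
    | tmul c d => simp [q.Sinv_mul]

/-- `scop` as a linear map. -/
def scopLin : H →ₗ[k] H ⊗[k] H := q.sswap.comp q.comul.toLinearMap

theorem scopLin_apply (x : H) : q.scopLin x = q.scop x := by
  simp [scopLin, scop, q.comul_eq x]

theorem scopLin_mul (x y : H) : q.scopLin (x * y) = q.scopLin y * q.scopLin x := by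
  simp [scopLin, sswap_mul]

theorem scopLin_one : q.scopLin 1 = 1 := by
  simp [scopLin, Algebra.TensorProduct.one_def, q.S_one]

theorem sswapInv_scop (x : H) : q.sswapInv (q.scop x) = q.comul x := by
  simp [scop, q.comul_eq x, q.Sinv_S]

theorem sswapInv_comul (x : H) : q.sswapInv (q.comul x) = q.scopOp x := by
  simp [scopOp, q.comul_eq x]

theorem map_Sinv_scop (x : H) : TensorProduct.map q.Sinv q.Sinv (q.scop x) = q.comulCop x := by
  simp [scop, comulCop, q.Sinv_S]

theorem map_Sinv_comul (x : H) : TensorProduct.map q.Sinv q.Sinv (q.comul x) = q.scopCop x := by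
  simp [scopCop, q.comul_eq x]

/-- The linear map `a ⊗ b ⊗ c ⊗ d ↦ a β S(d) ⊗ b β S(c)`. -/
def nestBeta : H ⊗[k] (H ⊗[k] (H ⊗[k] H)) →ₗ[k] H ⊗[k] H :=
  let L : H →ₗ[k] H ⊗[k] H := (Algebra.TensorProduct.includeLeft : H →ₐ[k] H ⊗[k] H).toLinearMap
  let R : H →ₗ[k] H ⊗[k] H := (Algebra.TensorProduct.includeRight : H →ₐ[k] H ⊗[k] H).toLinearMap
  let T : H →ₗ[k] H := (LinearMap.mulLeft k q.beta).comp q.S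
  mulMap L (mulMap R (mulMap (R.comp T) (L.comp T)))

/-- The linear map `a ⊗ b ⊗ c ⊗ d ↦ S(b) α c ⊗ S(a) α d`. -/
def nestAlpha : H ⊗[k] (H ⊗[k] (H ⊗[k] H)) →ₗ[k] H ⊗[k] H :=
  let L : H →ₗ[k] H ⊗[k] H := (Algebra.TensorProduct.includeLeft : H →ₐ[k] H ⊗[k] H).toLinearMap
  let R : H →ₗ[k] H ⊗[k] H := (Algebra.TensorProduct.includeRight : H →ₐ[k] H ⊗[k] H).toLinearMap
  let T : H →ₗ[k] H := (LinearMap.mulRight k q.alpha).comp q.S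
  mulMap (R.comp T) (mulMap (L.comp T) (mulMap L R))

@[simp]
theorem nestBeta_tmul (a b c d : H) : q.nestBeta (a ⊗ₜ (b ⊗ₜ (c ⊗ₜ d))) =
    (a * (q.beta * q.S d)) ⊗ₜ (b * (q.beta * q.S c)) := by
  simp [nestBeta]

@[simp]
theorem nestAlpha_tmul (a b c d : H) : q.nestAlpha (a ⊗ₜ (b ⊗ₜ (c ⊗ₜ d))) =
    (q.S b * q.alpha * c) ⊗ₜ (q.S a * q.alpha * d) := by
  simp [nestAlpha]

theorem nestBeta_mul_comulMid₃ (z : H ⊗[k] (H ⊗[k] (H ⊗[k] H))) (w : H ⊗[k] (H ⊗[k] H)) :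
    q.nestBeta (z * q.comulMid₃ w) = q.nestBeta (z * outer k H (q.counitMid w)) := by
  induction w using TensorProduct.induction_on_three with
  | zero => simp [tensor_mul_zero]
  | add w w' hw hw' => simp only [map_add, tensor_mul_add, hw, hw']
  | tmul c h d =>
    induction z using TensorProduct.induction_on_four with
    | zero => simp [tensor_zero_mul]
    | add x y hx hy => simp only [tensor_add_mul, map_add, hx, hy]
    | tmul x y u v =>
      have := congrArg (fun t => (x * (c * (q.beta * (q.S d * q.S v)))) ⊗ₜ[k] (y * (t * q.S u)))
        (q.antipode_beta h)
      simpa [tensor_mul_sum, tensor_mul_smul, Finset.mul_sum, Finset.sum_mul,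
        TensorProduct.tmul_sum, q.S_mul, mul_assoc] using this

theorem nestBeta_mul_outer_comul (z : H ⊗[k] (H ⊗[k] (H ⊗[k] H))) (h : H) :
    q.nestBeta (z * outer k H (q.comul h)) = q.counit h • q.nestBeta z := by
  induction z using TensorProduct.induction_on_four with
  | zero => simp [tensor_zero_mul]
  | add x y hx hy => simp only [tensor_add_mul, map_add, smul_add, hx, hy]
  | tmul x y u v =>
    have := congrArg (fun t => (x * (t * q.S v)) ⊗ₜ[k] (y * (q.beta * q.S u)))
      (q.antipode_beta h)
    simpa [q.comul_eq h, tensor_mul_sum, Finset.mul_sum, Finset.sum_mul, TensorProduct.sum_tmul,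
      TensorProduct.smul_tmul', q.S_mul, mul_assoc] using this

theorem nestBeta_comulFst₃_comulSnd_mul (z : H ⊗[k] (H ⊗[k] (H ⊗[k] H))) (w : H ⊗[k] H) :
    q.nestBeta (q.comulFst₃ (q.comulSnd w) * z) =
      mulMap q.comul.toLinearMap ((LinearMap.mulLeft k (q.nestBeta z)).comp q.scopLin) w := by
  induction w using TensorProduct.induction_on with
  | zero => simp [tensor_zero_mul]
  | add w w' hw hw' => simp only [map_add, tensor_add_mul, hw, hw']
  | tmul u v =>
    induction z using TensorProduct.induction_on_four with
    | zero => simp [tensor_mul_zero]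
    | add x y hx hy =>
      simp only [mulMap_tmul, LinearMap.comp_apply, LinearMap.mulLeft_apply] at hx hy ⊢
      simp only [tensor_mul_add, map_add, mul_add, add_mul, hx, hy]
    | tmul x y c d =>
      simp [scopLin_apply, scop, q.comul_eq u, q.comul_eq v, tensor_sum_mul, Finset.mul_sum,
        Finset.sum_mul, TensorProduct.tmul_sum, q.S_mul, mul_assoc]

theorem tensOne_mul_comm (x : H ⊗[k] (H ⊗[k] H)) (v : H) :
    tensOne k H x * (1 ⊗ₜ (1 ⊗ₜ (1 ⊗ₜ v))) = (1 ⊗ₜ (1 ⊗ₜ (1 ⊗ₜ v))) * tensOne k H x := by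
  induction x using TensorProduct.induction_on_three with
  | zero => simp [tensor_zero_mul, tensor_mul_zero]
  | add x y hx hy => simp only [map_add, tensor_mul_add, tensor_add_mul, hx, hy]
  | tmul a b c => simp

theorem comulFst₃_comulFst_mul_tensOne (w : H ⊗[k] H) :
    q.comulFst₃ (q.comulFst w) * tensOne k H q.PhiInv =
      tensOne k H q.PhiInv * q.comulMid₃ (q.comulFst w) := by
  induction w using TensorProduct.induction_on with
  | zero => simp [tensor_zero_mul, tensor_mul_zero]
  | add w w' hw hw' => simp only [map_add, tensor_mul_add, tensor_add_mul, hw, hw']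
  | tmul u v =>
    have h₁ : q.comulFst₃ (q.comulFst (u ⊗ₜ v)) =
        tensOne k H (q.comulFst (q.comul u)) * (1 ⊗ₜ (1 ⊗ₜ (1 ⊗ₜ v))) := by
      simp [q.comul_eq u, tensor_sum_mul]
    have h₂ : q.comulMid₃ (q.comulFst (u ⊗ₜ v)) =
        tensOne k H (q.comulSnd (q.comul u)) * (1 ⊗ₜ (1 ⊗ₜ (1 ⊗ₜ v))) := by
      simp [q.comul_eq u, tensor_sum_mul, q.comul_eq (q.d2 u _), TensorProduct.tmul_sum]
    rw [h₁, h₂, tensor_mul_assoc, ← tensOne_mul_comm, ← tensor_mul_assoc, ← tensor_mul_assoc,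
      ← map_mul, ← map_mul, PhiInv_mul_comulSnd_comul]

theorem nestAlpha_comulMid₃_mul (z : H ⊗[k] (H ⊗[k] (H ⊗[k] H))) (w : H ⊗[k] (H ⊗[k] H)) :
    q.nestAlpha (q.comulMid₃ w * z) = q.nestAlpha (outer k H (q.counitMid w) * z) := by
  induction w using TensorProduct.induction_on_three with
  | zero => simp [tensor_zero_mul]
  | add w w' hw hw' => simp only [map_add, tensor_add_mul, hw, hw']
  | tmul c h d =>
    induction z using TensorProduct.induction_on_four with
    | zero => simp [tensor_mul_zero]
    | add x y hx hy => simp only [tensor_mul_add, map_add, hx, hy]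
    | tmul x y u v =>
      have := congrArg (fun t => (q.S y * (t * u)) ⊗ₜ[k] (q.S x * (q.S c * (q.alpha * (d * v)))))
        (q.antipode_alpha h)
      simpa [tensor_sum_mul, tensor_smul_mul, Finset.mul_sum, Finset.sum_mul,
        TensorProduct.sum_tmul, TensorProduct.tmul_sum, TensorProduct.smul_tmul', q.S_mul,
        mul_assoc] using this

theorem nestAlpha_outer_comul_mul (z : H ⊗[k] (H ⊗[k] (H ⊗[k] H))) (h : H) :
    q.nestAlpha (outer k H (q.comul h) * z) = q.counit h • q.nestAlpha z := by
  induction z using TensorProduct.induction_on_four with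
  | zero => simp [tensor_mul_zero]
  | add x y hx hy => simp only [tensor_mul_add, map_add, smul_add, hx, hy]
  | tmul x y u v =>
    have := congrArg (fun t => (q.S y * (q.alpha * u)) ⊗ₜ[k] (q.S x * (t * v)))
      (q.antipode_alpha h)
    simpa [q.comul_eq h, tensor_sum_mul, Finset.mul_sum, Finset.sum_mul, TensorProduct.tmul_sum,
      q.S_mul, mul_assoc] using this

theorem nestAlpha_mul_comulLast₃_comulFst (z : H ⊗[k] (H ⊗[k] (H ⊗[k] H))) (w : H ⊗[k] H) :
    q.nestAlpha (z * q.comulLast₃ (q.comulFst w)) =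
      mulMap ((LinearMap.mulRight k (q.nestAlpha z)).comp q.scopLin) q.comul.toLinearMap w := by
  induction w using TensorProduct.induction_on with
  | zero => simp [tensor_mul_zero]
  | add w w' hw hw' => simp only [map_add, tensor_mul_add, hw, hw']
  | tmul u v =>
    induction z using TensorProduct.induction_on_four with
    | zero => simp [tensor_zero_mul]
    | add x y hx hy =>
      simp only [mulMap_tmul, LinearMap.comp_apply, LinearMap.mulRight_apply] at hx hy ⊢
      simp only [tensor_add_mul, map_add, mul_add, add_mul, hx, hy]
    | tmul x y c d =>
      simp only [comulFst_tmul, map_sum, tensor_mul_sum, mulMap_tmul, LinearMap.comp_apply,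
        scopLin_apply, scop, LinearMap.mulRight_apply, Finset.sum_mul]
      refine Finset.sum_congr rfl fun i _ => ?_
      simp [q.comul_eq v, Finset.mul_sum, TensorProduct.tmul_sum, q.S_mul,
        mul_assoc]

theorem oneTens_mul_comulLast₃_comulSnd (w : H ⊗[k] H) :
    oneTens k H q.PhiInv * q.comulLast₃ (q.comulSnd w) =
      q.comulMid₃ (q.comulSnd w) * oneTens k H q.PhiInv := by
  induction w using TensorProduct.induction_on with
  | zero => simp [tensor_zero_mul]
  | add w w' hw hw' => simp only [map_add, tensor_mul_add, tensor_add_mul, hw, hw']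
  | tmul u v => simp [PhiInv_mul_comulSnd_comul]

theorem bEl_eq : q.bEl = q.nestBeta (q.comulFst₃ q.Phi * tensOne k H q.PhiInv) := by
  simp only [bEl, Phi, PhiInv, map_sum, tensor_mul_sum, tensor_sum_mul, comulFst₃_tmul,
    tensOne_tmul]
  rw [Finset.sum_comm]
  simp [q.S_mul, mul_assoc]

theorem aEl_eq : q.aEl = q.nestAlpha (oneTens k H q.PhiInv * q.comulLast₃ q.Phi) := by
  simp only [aEl, Phi, PhiInv, map_sum, tensor_mul_sum, tensor_sum_mul]
  refine Finset.sum_congr rfl fun a _ => Finset.sum_congr rfl fun b _ => ?_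
  simp [q.comul_eq (q.P3 a), Finset.mul_sum, TensorProduct.tmul_sum, q.S_mul, mul_assoc]

theorem aElOp_eq : q.aElOp =
    q.sswapInv (q.nestBeta (q.comulLast₃ q.PhiInv * oneTens k H q.Phi)) := by
  simp only [aElOp, Phi, PhiInv, map_sum, tensor_mul_sum, tensor_sum_mul]
  rw [Finset.sum_comm]
  refine Finset.sum_congr rfl fun a _ => Finset.sum_congr rfl fun b _ => ?_
  simp [q.comul_eq (q.Q3 b), Finset.sum_mul, TensorProduct.tmul_sum, q.Sinv_mul, q.Sinv_S,
    mul_assoc]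

theorem aElCop_eq : q.aElCop = TensorProduct.map q.Sinv q.Sinv
    (q.nestAlpha (tensOne k H q.Phi * q.comulFst₃ q.PhiInv)) := by
  simp only [aElCop, Phi, PhiInv, map_sum, tensor_mul_sum, tensor_sum_mul]
  rw [Finset.sum_comm]
  refine Finset.sum_congr rfl fun b _ => Finset.sum_congr rfl fun a _ => ?_
  simp [tensor_mul_sum, q.Sinv_mul, q.Sinv_S, mul_assoc]

theorem aElOp_eq_sswapInv_bEl : q.aElOp = q.sswapInv q.bEl := by
  have h : q.comulFst₃ q.Phi * tensOne k H q.PhiInv =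
      q.comulLast₃ q.PhiInv * oneTens k H q.Phi * q.comulMid₃ q.Phi := by
    have := congrArg (fun t => q.comulLast₃ q.PhiInv * t * tensOne k H q.PhiInv) q.pentagon_Phi
    simpa only [tensor_mul_assoc, map_Phi_mul_map_PhiInv, tensor_mul_one,
      ← tensor_mul_assoc (q.comulLast₃ q.PhiInv) (q.comulLast₃ q.Phi), map_PhiInv_mul_map_Phi,
      tensor_one_mul] using this
  rw [aElOp_eq, bEl_eq, h, nestBeta_mul_comulMid₃, counitMid_Phi, outer_one, tensor_mul_one]

theorem aElCop_eq_map_aEl : q.aElCop = TensorProduct.map q.Sinv q.Sinv q.aEl := by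
  have h : oneTens k H q.PhiInv * q.comulLast₃ q.Phi =
      q.comulMid₃ q.Phi * (tensOne k H q.Phi * q.comulFst₃ q.PhiInv) := by
    have := congrArg (fun t => oneTens k H q.PhiInv * t * q.comulFst₃ q.PhiInv) q.pentagon_Phi
    simpa only [tensor_mul_assoc, map_Phi_mul_map_PhiInv, tensor_mul_one,
      ← tensor_mul_assoc (oneTens k H q.PhiInv) (oneTens k H q.Phi), map_PhiInv_mul_map_Phi,
      tensor_one_mul] using this
  rw [aElCop_eq, aEl_eq, h, nestAlpha_comulMid₃_mul, counitMid_Phi, outer_one, tensor_one_mul]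

/-- `Δ(h₍₁₎) 𝕓 (S ⊗ S)(Δ^cop(h₍₂₎)) = ε(h) 𝕓` -/
theorem sum_comul_mul_bEl_mul_scopLin (h : H) :
    ∑ i ∈ Finset.range (q.n h), q.comul (q.d1 h i) * q.bEl * q.scopLin (q.d2 h i) =
      q.counit h • q.bEl := by
  have h₁ := q.nestBeta_comulFst₃_comulSnd_mul
    (q.comulFst₃ q.Phi * tensOne k H q.PhiInv) (q.comul h)
  rw [← tensor_mul_assoc, ← map_mul, comulSnd_comul_mul_Phi, map_mul q.comulFst₃, tensor_mul_assoc,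
    comulFst₃_comulFst_mul_tensOne, ← tensor_mul_assoc, nestBeta_mul_comulMid₃,
    counitMid_comulFst, nestBeta_mul_outer_comul, ← bEl_eq] at h₁
  rw [h₁]
  simp [q.comul_eq h, mul_assoc]

/-- `(S ⊗ S)(Δ^cop(h₍₁₎)) 𝕒 Δ(h₍₂₎) = ε(h) 𝕒` -/
theorem sum_scopLin_mul_aEl_mul_comul (h : H) :
    ∑ i ∈ Finset.range (q.n h), q.scopLin (q.d1 h i) * q.aEl * q.comul (q.d2 h i) =
      q.counit h • q.aEl := by
  have h₁ := q.nestAlpha_mul_comulLast₃_comulFst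
    (oneTens k H q.PhiInv * q.comulLast₃ q.Phi) (q.comul h)
  rw [tensor_mul_assoc, ← map_mul, ← comulSnd_comul_mul_Phi, map_mul q.comulLast₃,
    ← tensor_mul_assoc, oneTens_mul_comulLast₃_comulSnd, tensor_mul_assoc, nestAlpha_comulMid₃_mul,
    counitMid_comulSnd, nestAlpha_outer_comul_mul, ← aEl_eq] at h₁
  rw [h₁]
  simp [q.comul_eq h, mul_assoc]

theorem twistOp_eq : q.twistOp = q.sswapInv q.twistInv := by
  have h := q.sum_qR_eq_sum_qL q.scopLin_mul q.scopLin_one q.sum_comul_mul_bEl_mul_scopLin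
  simp only [scopLin_apply] at h
  rw [twistInv, ← h, twistOp, map_sum]
  refine Finset.sum_congr rfl fun i _ => ?_
  rw [sswapInv_mul, sswapInv_mul, sswapInv_scop, sswapInv_comul, ← aElOp_eq_sswapInv_bEl, qR1,
    qR2, Sinv_mul, mul_assoc]

theorem twistCop_eq : q.twistCop = TensorProduct.map q.Sinv q.Sinv q.twist := by
  have h := q.sum_pL_eq_sum_pR q.scopLin_mul q.scopLin_one q.sum_scopLin_mul_aEl_mul_comul
  simp only [scopLin_apply] at h
  rw [twist, ← h, twistCop, map_sum]
  refine Finset.sum_congr rfl fun i _ => ?_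
  rw [map_Sinv_mul, map_Sinv_mul, map_Sinv_scop, map_Sinv_comul, ← aElCop_eq_map_aEl, pL1, pL2,
    Sinv_mul, mul_assoc, mul_assoc (q.P2 i)]

end QuasiHopf

/-- The Drinfeld twists of `H^op` and `H^cop` are
`f_op = S̄(f̄2) ⊗ S̄(f̄1)` and `f_cop = S̄(f1) ⊗ S̄(f2)`. -/
theorem statement0 (k H : Type) [Field k] [Ring H] [Algebra k H] (q : QuasiHopf k H) :
    q.twistOp = q.sswapInv q.twistInv ∧
    q.twistCop = TensorProduct.map q.Sinv q.Sinv q.twist :=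
  ⟨q.twistOp_eq, q.twistCop_eq⟩
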